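/- arXiv:2306.04381 — 2 statements merged into one kernel-verified Lean document; each statement's English description precedes it below -/
import Mathlib

section
/- Let H be a connected graded Hopf algebra with a natural growth operator ⊤, and for i ≥ 1 define F_i: P(H)^{⊗i} → H by F_i(p_i ⊗ ⋯ ⊗ p_1) := p_i ⊤ ⋯ ⊤ p_1. Then: (i) Δ̂^{i−1} ∘ F_i equals the canonical inclusion of P(H)^{⊗i} into H^{⊗i}; (ii) Δ̂^{i+k} ∘ F_i = 0 for all k ≥ 0; (iii) each F_i is injective; and (iv) the sum K·1 + Σ_{i=1}^{∞} Im(F_i) is a direct sum inside H. -/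
open TensorProduct

section NaturalGrowthPrelude

variable (K H : Type*) [CommRing K] [Ring H] [HopfAlgebra K H]

/-- The reduced coproduct `Δ̂(x) = Δ(x) − x ⊗ 1 − 1 ⊗ x`. -/
noncomputable def reducedComul : H →ₗ[K] H ⊗[K] H :=
  Coalgebra.comul - (TensorProduct.mk K H H).flip 1 - TensorProduct.mk K H H 1

variable {K H}

/-- `⊤` is a natural growth operator: `Δ̂(x ⊤ y) = x ⊗ y + x⁽¹⁾ ⊗ (x⁽²⁾ ⊤ y)`
for all `x` and all primitive `y` (i.e. `Δ̂(y) = 0`). -/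
def IsNaturalGrowth (top : H →ₗ[K] H →ₗ[K] H) : Prop :=
  ∀ x y : H, reducedComul K H y = 0 →
    reducedComul K H (top x y) =
      x ⊗ₜ[K] y +
        (TensorProduct.map LinearMap.id (top.flip y)) (reducedComul K H x)

/-- A connected grading on a Hopf algebra, compatible with product and coproduct. -/
structure HopfGrading : Type _ where
  grade : ℕ → Submodule K H
  internal : DirectSum.IsInternal grade
  connected : grade 0 = (K ∙ (1 : H))
  mul_mem : ∀ {i j : ℕ} {x y : H}, x ∈ grade i → y ∈ grade j → x * y ∈ grade (i + j)
  comul_mem : ∀ (n : ℕ), ∀ x ∈ grade n,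
    Coalgebra.comul (R := K) x ∈
      ⨆ p : {p : ℕ × ℕ // p.1 + p.2 = n},
        LinearMap.range
          (TensorProduct.map (grade p.1.1).subtype (grade p.1.2).subtype)

/-- `nestAux top p a k = p_{a+k} ⊤ p_{a+k-1} ⊤ ⋯ ⊤ p_a` (left-nested:
`(p_{a+k} ⊤ ⋯ ⊤ p_{a+1}) ⊤ p_a`). -/
noncomputable def nestAux (top : H →ₗ[K] H →ₗ[K] H) (p : ℕ → H) : ℕ → ℕ → H
  | a, 0 => p a
  | a, k + 1 => top (nestAux top p (a + 1) k) (p a)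

/-- `nest top p a b = p_b ⊤ p_{b-1} ⊤ ⋯ ⊤ p_a` (for `a ≤ b`),
i.e. the iterated natural growth product `(p_b ⊤ ⋯ ⊤ p_{a+1}) ⊤ p_a`. -/
noncomputable def nest (top : H →ₗ[K] H →ₗ[K] H) (p : ℕ → H) (a b : ℕ) : H :=
  nestAux top p a (b - a)

end NaturalGrowthPrelude

/-!
STATEMENT 8: Let H be a connected graded Hopf algebra with a natural growth operator ⊤
and, for i ≥ 1, F_i : P(H)^{⊗i} → H, F_i(p_i ⊗ ⋯ ⊗ p_1) := p_i ⊤ ⋯ ⊤ p_1.  Then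
(i) Δ̂^{i−1} ∘ F_i is the canonical inclusion P(H)^{⊗i} → H^{⊗i};
(ii) Δ̂^{i+k} ∘ F_i = 0 for all k ≥ 0;  (iii) each F_i is injective;
(iv) the sum K·1 + Σ_{i≥1} Im(F_i) is direct.
(Here `F_i` with `i` tensor factors is `Fmap top (i-1)` below, and `Δ̂^m` is `redPow m`.)
-/

universe u

section TensorPowers

variable (K : Type u) [Field K] (H : Type u) [Ring H] [HopfAlgebra K H]

/-- Left-nested tensor powers of `H`: `TP 0 = H`, `TP (n+1) = TP n ⊗ H`
(so `TP n` has `n+1` tensor factors). -/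
noncomputable def TP : ℕ → ModuleCat K
  | 0 => ModuleCat.of K H
  | n + 1 => ModuleCat.of K ((TP n : Type u) ⊗[K] H)

/-- The iterated reduced coproduct `Δ̂ⁿ : H → H^{⊗(n+1)}`; `Δ̂⁰ = id`,
`Δ̂ⁿ⁺¹ = (Δ̂ⁿ ⊗ id) ∘ Δ̂`. -/
noncomputable def redPow : (n : ℕ) → H →ₗ[K] (TP K H n : Type u)
  | 0 => LinearMap.id
  | n + 1 => (TensorProduct.map (redPow n) LinearMap.id) ∘ₗ reducedComul K H

/-- The submodule of primitive elements `P(H) = {x | Δ̂(x) = 0}`. -/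
noncomputable def Prim : Submodule K H := LinearMap.ker (reducedComul K H)

/-- Left-nested tensor powers of the space of primitives:
`PTP n = P(H)^{⊗(n+1)}`. -/
noncomputable def PTP : ℕ → ModuleCat K
  | 0 => ModuleCat.of K (Prim K H)
  | n + 1 => ModuleCat.of K ((PTP n : Type u) ⊗[K] (Prim K H))

/-- The canonical inclusion `P(H)^{⊗(n+1)} → H^{⊗(n+1)}`. -/
noncomputable def inclPTP : (n : ℕ) → (PTP K H n : Type u) →ₗ[K] (TP K H n : Type u)
  | 0 => (Prim K H).subtype
  | n + 1 => TensorProduct.map (inclPTP n) (Prim K H).subtype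

variable {K H}

/-- `Fmap top n : P(H)^{⊗(n+1)} → H` sends the pure tensor `p_{n+1} ⊗ ⋯ ⊗ p_1`
(left-nested) to `p_{n+1} ⊤ ⋯ ⊤ p_1`; i.e. `Fmap top (i-1) = F_i`. -/
noncomputable def Fmap (top : H →ₗ[K] H →ₗ[K] H) :
    (n : ℕ) → (PTP K H n : Type u) →ₗ[K] H
  | 0 => (Prim K H).subtype
  | n + 1 => TensorProduct.lift ((top ∘ₗ Fmap top n).compl₂ (Prim K H).subtype)

end TensorPowers

section Independence

/-- A sequence of submodules is independent as soon as, for each `i`, some submodule contains all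
the earlier members and is disjoint from the `i`-th one. -/
theorem iSupIndep_of_disjoint_of_lt_le {R M : Type*} [Ring R] [AddCommGroup M] [Module R M]
    (p q : ℕ → Submodule R M) (hd : ∀ i, Disjoint (p i) (q i)) (hle : ∀ i j, j < i → p j ≤ q i) :
    iSupIndep p := by
  classical
  rw [iSupIndep_iff_finsetSum_eq_zero_imp_eq_zero]
  intro s v hv hsum
  by_contra! hne
  obtain ⟨i, his, hi⟩ := hne
  obtain ⟨m, hm, hmax⟩ := (s.filter (v · ≠ 0)).exists_max_image id
    ⟨i, Finset.mem_filter.2 ⟨his, hi⟩⟩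
  rw [Finset.mem_filter] at hm
  refine hm.2 (Submodule.disjoint_def.1 (hd m) _ (hv m hm.1) ?_)
  rw [← Finset.add_sum_erase s v hm.1, add_eq_zero_iff_eq_neg] at hsum
  rw [hsum]
  refine neg_mem (sum_mem fun j hj => ?_)
  rw [Finset.mem_erase] at hj
  by_cases h0 : v j = 0
  · rw [h0]
    exact zero_mem _
  · exact hle m j (lt_of_le_of_ne (hmax j (Finset.mem_filter.2 ⟨hj.2, h0⟩)) hj.1) (hv j hj.2)

end Independence

section NaturalGrowth

variable {K : Type u} [Field K] {H : Type u} [Ring H] [HopfAlgebra K H]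

theorem reducedComul_apply (x : H) :
    reducedComul K H x = Coalgebra.comul x - x ⊗ₜ[K] 1 - 1 ⊗ₜ[K] x := rfl

/-- The span of the iterated growth products of fewer than `n + 1` primitives. -/
noncomputable def growthSpan (top : H →ₗ[K] H →ₗ[K] H) (n : ℕ) : Submodule K H :=
  ⨆ k : Fin n, LinearMap.range (Fmap top k)

theorem growthSpan_le_iff {top : H →ₗ[K] H →ₗ[K] H} {n : ℕ} {V : Submodule K H} :
    growthSpan top n ≤ V ↔ ∀ k < n, LinearMap.range (Fmap top k) ≤ V := by
  simp only [growthSpan, iSup_le_iff]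
  exact ⟨fun h k hk => h ⟨k, hk⟩, fun h k => h k k.2⟩

theorem range_Fmap_le_growthSpan (top : H →ₗ[K] H →ₗ[K] H) {k n : ℕ} (h : k < n) :
    LinearMap.range (Fmap top k) ≤ growthSpan top n :=
  growthSpan_le_iff.1 le_rfl k h

theorem growthSpan_mono (top : H →ₗ[K] H →ₗ[K] H) {m n : ℕ} (h : m ≤ n) :
    growthSpan top m ≤ growthSpan top n :=
  growthSpan_le_iff.2 fun _ hk => range_Fmap_le_growthSpan top (hk.trans_le h)

/-- The image of `V ⊗ H` in `H ⊗ H`. -/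
noncomputable def tensorLeft (V : Submodule K H) : Submodule K (H ⊗[K] H) :=
  LinearMap.range (TensorProduct.map V.subtype (LinearMap.id : H →ₗ[K] H))

theorem tmul_mem_tensorLeft {V : Submodule K H} {x : H} (hx : x ∈ V) (y : H) :
    x ⊗ₜ[K] y ∈ tensorLeft V :=
  ⟨(⟨x, hx⟩ : V) ⊗ₜ y, rfl⟩

theorem tensorLeft_le_iff {V : Submodule K H} {W : Submodule K (H ⊗[K] H)} :
    tensorLeft V ≤ W ↔ ∀ x ∈ V, ∀ y : H, x ⊗ₜ[K] y ∈ W := by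
  refine ⟨fun h x hx y => h (tmul_mem_tensorLeft hx y), ?_⟩
  rintro h _ ⟨t, rfl⟩
  induction t with
  | zero => simp
  | tmul x y => exact h x x.2 y
  | add a b ha hb =>
    rw [map_add]
    exact add_mem ha hb

theorem map_eq_zero_of_mem_tensorLeft {M N : Type*} [AddCommGroup M] [Module K M]
    [AddCommGroup N] [Module K N] {V : Submodule K H} {f : H →ₗ[K] M} (g : H →ₗ[K] N)
    (hf : V ≤ LinearMap.ker f) {t : H ⊗[K] H} (ht : t ∈ tensorLeft V) :
    TensorProduct.map f g t = 0 := by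
  suffices tensorLeft V ≤ LinearMap.ker (TensorProduct.map f g) from this ht
  refine tensorLeft_le_iff.2 fun x hx y => ?_
  have : f x = 0 := hf hx
  simp [this]

theorem reducedComul_Fmap_succ_tmul {top : H →ₗ[K] H →ₗ[K] H} (htop : IsNaturalGrowth top)
    (n : ℕ) (t : PTP K H n) (p : Prim K H) :
    reducedComul K H (Fmap top (n + 1) (t ⊗ₜ[K] p)) =
      Fmap top n t ⊗ₜ[K] (p : H) +
        TensorProduct.map LinearMap.id (top.flip p) (reducedComul K H (Fmap top n t)) :=
  htop _ _ p.2

theorem map_id_mem_tensorLeft {V : Submodule K H} (g : H →ₗ[K] H) {t : H ⊗[K] H}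
    (ht : t ∈ tensorLeft V) : TensorProduct.map LinearMap.id g t ∈ tensorLeft V := by
  suffices tensorLeft V ≤ (tensorLeft V).comap (TensorProduct.map LinearMap.id g) from this ht
  exact tensorLeft_le_iff.2 fun x hx y => tmul_mem_tensorLeft hx (g y)

theorem tensorLeft_mono {V W : Submodule K H} (h : V ≤ W) : tensorLeft V ≤ tensorLeft W :=
  tensorLeft_le_iff.2 fun _ hx y => tmul_mem_tensorLeft (h hx) y

theorem PTP_succ_induction {n : ℕ} {motive : PTP K H (n + 1) → Prop} (t : PTP K H (n + 1))
    (zero : motive 0)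
    (tmul : ∀ (t : PTP K H n) (p : Prim K H), motive (t ⊗ₜ[K] p : (PTP K H n : Type u) ⊗[K] _))
    (add : ∀ a b, motive a → motive b → motive (a + b)) : motive t :=
  TensorProduct.induction_on (motive := motive) t zero tmul add

theorem reducedComul_Fmap_mem {top : H →ₗ[K] H →ₗ[K] H} (htop : IsNaturalGrowth top) (n : ℕ)
    (t : PTP K H n) : reducedComul K H (Fmap top n t) ∈ tensorLeft (growthSpan top n) := by
  induction n with
  | zero =>
    have : reducedComul K H (Fmap top 0 t) = 0 := t.2
    rw [this]
    exact zero_mem _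
  | succ n ih =>
    induction t using PTP_succ_induction with
    | zero =>
      rw [map_zero, map_zero]
      exact zero_mem _
    | tmul t p =>
      rw [reducedComul_Fmap_succ_tmul htop]
      exact add_mem
        (tmul_mem_tensorLeft (range_Fmap_le_growthSpan top n.lt_succ_self ⟨t, rfl⟩) _)
        (tensorLeft_mono (growthSpan_mono top n.le_succ) (map_id_mem_tensorLeft _ (ih t)))
    | add a b ha hb =>
      rw [map_add, map_add]
      exact add_mem ha hb

theorem redPow_succ_apply (m : ℕ) (x : H) :
    redPow K H (m + 1) x =
      TensorProduct.map (redPow K H m) LinearMap.id (reducedComul K H x) := rfl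

theorem growthSpan_le_ker_redPow {top : H →ₗ[K] H →ₗ[K] H} (htop : IsNaturalGrowth top) (m : ℕ) :
    growthSpan top m ≤ LinearMap.ker (redPow K H m) := by
  induction m with
  | zero => exact growthSpan_le_iff.2 fun k hk => absurd hk k.not_lt_zero
  | succ m ih =>
    refine growthSpan_le_iff.2 fun k hk => ?_
    rintro _ ⟨t, rfl⟩
    rw [LinearMap.mem_ker, redPow_succ_apply]
    exact map_eq_zero_of_mem_tensorLeft _
      ((growthSpan_mono top (Nat.lt_succ_iff.1 hk)).trans ih) (reducedComul_Fmap_mem htop k t)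

theorem redPow_Fmap {top : H →ₗ[K] H →ₗ[K] H} (htop : IsNaturalGrowth top) (n : ℕ)
    (t : PTP K H n) : redPow K H n (Fmap top n t) = inclPTP K H n t := by
  induction n with
  | zero => rfl
  | succ n ih =>
    induction t using PTP_succ_induction with
    | zero => simp only [map_zero]
    | tmul t p =>
      rw [redPow_succ_apply, reducedComul_Fmap_succ_tmul htop, map_add,
        map_eq_zero_of_mem_tensorLeft _ (growthSpan_le_ker_redPow htop n)
          (map_id_mem_tensorLeft _ (reducedComul_Fmap_mem htop n t)), add_zero,
        TensorProduct.map_tmul, ih]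
      rfl
    | add a b ha hb =>
      rw [map_add, map_add, map_add, ha, hb]

theorem inclPTP_injective (n : ℕ) : Function.Injective (inclPTP K H n) := by
  induction n with
  | zero => exact Subtype.val_injective
  | succ n ih =>
    exact TensorProduct.map_injective_of_flat_flat _ _ ih (Prim K H).injective_subtype

theorem Fmap_injective {top : H →ₗ[K] H →ₗ[K] H} (htop : IsNaturalGrowth top) (n : ℕ) :
    Function.Injective (Fmap top n) := by
  refine Function.Injective.of_comp (f := redPow K H n) ?_
  convert inclPTP_injective (K := K) (H := H) n using 1
  exact funext (redPow_Fmap htop n)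

theorem lid_map_counit_reducedComul (x : H) :
    TensorProduct.lid K K (TensorProduct.map Coalgebra.counit Coalgebra.counit
      (reducedComul K H x)) = -Coalgebra.counit (R := K) x := by
  have h : TensorProduct.map Coalgebra.counit Coalgebra.counit (Coalgebra.comul (R := K) x) =
      (1 : K) ⊗ₜ[K] Coalgebra.counit (R := K) x := by
    rw [← LinearMap.lTensor_comp_rTensor, LinearMap.comp_apply, Coalgebra.rTensor_counit_comul,
      LinearMap.lTensor_tmul]
  rw [reducedComul_apply, map_sub, map_sub, map_sub, map_sub, h]
  simp

theorem counit_Fmap {top : H →ₗ[K] H →ₗ[K] H} (htop : IsNaturalGrowth top) (n : ℕ)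
    (t : PTP K H n) : Coalgebra.counit (R := K) (Fmap top n t) = 0 := by
  induction n using Nat.strong_induction_on with
  | _ n ih =>
    have hker : growthSpan top n ≤ LinearMap.ker (Coalgebra.counit (R := K) (A := H)) := by
      refine growthSpan_le_iff.2 fun k hk => ?_
      rintro _ ⟨s, rfl⟩
      exact ih k hk s
    rw [← neg_eq_zero, ← lid_map_counit_reducedComul,
      map_eq_zero_of_mem_tensorLeft _ hker (reducedComul_Fmap_mem htop n t), map_zero]

/-- The projection `x ↦ x - ε(x) 1` onto the augmentation ideal. -/
noncomputable def augProj (K : Type u) [Field K] (H : Type u) [Ring H] [HopfAlgebra K H] :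
    H →ₗ[K] H :=
  LinearMap.id - Algebra.linearMap K H ∘ₗ Coalgebra.counit

theorem augProj_one : augProj K H 1 = 0 := by
  simp [augProj]

theorem augProj_Fmap {top : H →ₗ[K] H →ₗ[K] H} (htop : IsNaturalGrowth top) (n : ℕ)
    (t : PTP K H n) : augProj K H (Fmap top n t) = Fmap top n t := by
  simp [augProj, counit_Fmap htop]

theorem iSupIndep_range_Fmap {top : H →ₗ[K] H →ₗ[K] H} (htop : IsNaturalGrowth top) :
    iSupIndep (fun i : ℕ =>
      match i with
      | 0 => (K ∙ (1 : H))
      | j + 1 => LinearMap.range (Fmap top j)) := by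
  refine iSupIndep_of_disjoint_of_lt_le _
    (fun i => match i with
      | 0 => ⊥
      | j + 1 => LinearMap.ker (redPow K H j ∘ₗ augProj K H)) ?_ ?_
  · rintro (_ | n)
    · exact disjoint_bot_right
    · rw [Submodule.disjoint_def]
      rintro _ ⟨t, rfl⟩ ht
      rw [LinearMap.mem_ker, LinearMap.comp_apply, augProj_Fmap htop, redPow_Fmap htop] at ht
      rw [(map_eq_zero_iff _ (inclPTP_injective n)).1 ht, map_zero]
  · rintro (_ | n) (_ | m) hmn
    · exact absurd hmn (Nat.not_lt_zero _)
    · exact absurd hmn (Nat.not_lt_zero _)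
    · rw [Submodule.span_singleton_le_iff_mem, LinearMap.mem_ker, LinearMap.comp_apply,
        augProj_one, map_zero]
    · rintro _ ⟨t, rfl⟩
      rw [LinearMap.mem_ker, LinearMap.comp_apply, augProj_Fmap htop]
      exact growthSpan_le_ker_redPow htop n
        (range_Fmap_le_growthSpan top (Nat.succ_lt_succ_iff.1 hmn) ⟨t, rfl⟩)

end NaturalGrowth

theorem Fmaps_properties {K : Type u} [Field K] [CharZero K]
    {H : Type u} [Ring H] [HopfAlgebra K H]
    (G : HopfGrading (K := K) (H := H))
    (top : H →ₗ[K] H →ₗ[K] H) (htop : IsNaturalGrowth top) :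
    -- (i)  Δ̂^{i-1} ∘ F_i is the canonical inclusion
    (∀ n : ℕ, redPow K H n ∘ₗ Fmap top n = inclPTP K H n) ∧
    -- (ii) Δ̂^{i+k} ∘ F_i = 0 for k ≥ 0
    (∀ n m : ℕ, n < m → redPow K H m ∘ₗ Fmap top n = 0) ∧
    -- (iii) each F_i is injective
    (∀ n : ℕ, Function.Injective (Fmap top n)) ∧
    -- (iv) the sum K·1 + Σ_{i ≥ 1} Im(F_i) is direct
    iSupIndep (fun i : ℕ =>
      match i with
      | 0 => (K ∙ (1 : H))
      | j + 1 => LinearMap.range (Fmap top j)) := by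
  refine ⟨fun n => LinearMap.ext (redPow_Fmap htop n), fun n m hnm => LinearMap.ext fun t => ?_,
    Fmap_injective htop, iSupIndep_range_Fmap htop⟩
  exact growthSpan_le_ker_redPow htop m (range_Fmap_le_growthSpan top hnm ⟨t, rfl⟩)
end

section
/- Let H be a connected graded Hopf algebra with a natural growth operator ⊤, let n ≥ 1, and let (p_{i,j})_{1 ≤ i ≤ j ≤ n} be any family of primitive elements of H. Let C be a vector space of dimension n + 1 with basis (e_0, …, e_n), and define Δ_C(e_0) = 1 ⊗ e_0 and Δ_C(e_i) = Σ_{j=0}^{i−1} [ Σ_{I_{i_1,j_1}, …, I_{i_k,j_k} ∈ D_{j+1,i}} p_{i_k,j_k} ⊤ ⋯ ⊤ p_{i_1,j_1} ⊗ e_j ] + 1 ⊗ e_i. Then (C, Δ_C) is an H-comodule (denoted C_{(p_{i,j})}). -/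
open TensorProduct

/-!
STATEMENT 9: Let H be a connected graded Hopf algebra with a natural growth operator ⊤,
n ≥ 1, and (p_{i,j})_{1 ≤ i ≤ j ≤ n} a family of primitive elements.  Let C be the
(n+1)-dimensional space with basis (e_0,…,e_n) and define
Δ_C(e_i) = Σ_{j=0}^{i−1} [ Σ_{decompositions of I_{j+1,i}} p_{i_k,j_k} ⊤ ⋯ ⊤ p_{i_1,j_1} ⊗ e_j ]
           + 1 ⊗ e_i.
Then (C, Δ_C) is an H-comodule.
(A decomposition of the interval [a,b] is encoded by its finite set of interior cut
points c ⊆ {a,…,b−1}; the corresponding intervals are [a,j_1], [j_1+1,j_2], …, [j_{k-1}+1,b].)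
-/

section Comodule

variable {K H : Type*} [Field K] [CharZero K] [Ring H] [HopfAlgebra K H]

/-- Given a family `p` of elements indexed by pairs, a sorted list `L` of interior cut
points of the interval `[a,b]` determines the iterated natural growth product
`p_{i_k,j_k} ⊤ ⋯ ⊤ p_{i_1,j_1}` over the intervals of the decomposition
(the first interval `[a, j_1]` being outermost on the right). -/
noncomputable def decompProd (top : H →ₗ[K] H →ₗ[K] H) (p : ℕ → ℕ → H) :
    ℕ → ℕ → List ℕ → H
  | a, b, [] => p a b
  | a, b, j :: L => top (decompProd top p (j + 1) b L) (p a j)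

/-- The sum over all decompositions of the interval `[a,b]` of the iterated natural
growth products `p_{i_k,j_k} ⊤ ⋯ ⊤ p_{i_1,j_1}`. -/
noncomputable def decompSum (top : H →ₗ[K] H →ₗ[K] H) (p : ℕ → ℕ → H) (a b : ℕ) : H :=
  ∑ c ∈ (Finset.Ico a b).powerset, decompProd top p a b (c.sort (· ≤ ·))

/-- The coaction `Δ_C` on the space `C = K^{n+1}` with basis `e_0, …, e_n`:
`Δ_C(e_i) = Σ_{j<i} (Σ_{decompositions of I_{j+1,i}} p_{i_k,j_k} ⊤ ⋯ ⊤ p_{i_1,j_1}) ⊗ e_j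
            + 1 ⊗ e_i`. -/
noncomputable def comoduleCoaction (top : H →ₗ[K] H →ₗ[K] H) (p : ℕ → ℕ → H) (n : ℕ) :
    (Fin (n + 1) → K) →ₗ[K] H ⊗[K] (Fin (n + 1) → K) :=
  (Pi.basisFun K (Fin (n + 1))).constr ℕ fun i =>
    (∑ j ∈ Finset.univ.filter (fun j : Fin (n + 1) => j < i),
      decompSum top p ((j : ℕ) + 1) (i : ℕ) ⊗ₜ[K] Pi.single j (1 : K)) +
    (1 : H) ⊗ₜ[K] Pi.single i (1 : K)

end Comodule

section NaturalGrowthLemmas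

variable {K H : Type*} [CommRing K] [Ring H] [HopfAlgebra K H]

lemma comul_eq_reducedComul_add (x : H) :
    Coalgebra.comul (R := K) x = reducedComul K H x + x ⊗ₜ[K] 1 + 1 ⊗ₜ[K] x := by
  simp only [reducedComul, LinearMap.sub_apply, LinearMap.flip_apply, TensorProduct.mk_apply]
  abel

lemma counit_rTensor_reducedComul (x : H) :
    (Coalgebra.counit (R := K) (A := H)).rTensor H (reducedComul K H x) =
      -(Coalgebra.counit (R := K) x ⊗ₜ[K] (1 : H)) := by
  simp [reducedComul]

lemma counit_eq_zero_of_reducedComul_eq_zero {y : H} (hy : reducedComul K H y = 0) :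
    Coalgebra.counit (R := K) y = 0 := by
  have h := counit_rTensor_reducedComul (K := K) y
  rw [hy, map_zero, eq_comm, neg_eq_zero] at h
  simpa using congrArg
    (LinearMap.mul' K K ∘ₗ TensorProduct.map LinearMap.id (Coalgebra.counit (R := K))) h

lemma IsNaturalGrowth.counit_eq_zero {top : H →ₗ[K] H →ₗ[K] H} (htop : IsNaturalGrowth top)
    {x y : H} (hx : Coalgebra.counit (R := K) x = 0) (hy : reducedComul K H y = 0) :
    Coalgebra.counit (R := K) (top x y) = 0 := by
  have h := counit_rTensor_reducedComul (K := K) (top x y)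
  have hcomm : (Coalgebra.counit (R := K) (A := H)).rTensor H
      (TensorProduct.map LinearMap.id (top.flip y) (reducedComul K H x)) =
      (top.flip y).lTensor K
        ((Coalgebra.counit (R := K) (A := H)).rTensor H (reducedComul K H x)) := by
    rw [← LinearMap.lTensor_def, ← LinearMap.comp_apply, LinearMap.rTensor_comp_lTensor,
      ← LinearMap.lTensor_comp_rTensor, LinearMap.comp_apply]
  rw [htop x y hy, map_add, hcomm, counit_rTensor_reducedComul, LinearMap.rTensor_tmul, hx,
    TensorProduct.zero_tmul, TensorProduct.zero_tmul, neg_zero, map_zero, add_zero, eq_comm,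
    neg_eq_zero] at h
  simpa using congrArg
    (LinearMap.mul' K K ∘ₗ TensorProduct.map LinearMap.id (Coalgebra.counit (R := K))) h

end NaturalGrowthLemmas

section DecompSum

variable {K H : Type*} [Field K] [Ring H] [HopfAlgebra K H]

lemma sum_powerset_Ico_decompProd (top : H →ₗ[K] H →ₗ[K] H) (p : ℕ → ℕ → H) (a b : ℕ)
    {m : ℕ} (hm : m ≤ b) :
    ∑ c ∈ (Finset.Ico m b).powerset, decompProd top p a b (c.sort (· ≤ ·)) =
      p a b + ∑ j ∈ Finset.Ico m b, top (decompSum top p (j + 1) b) (p a j) := by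
  induction hm using Nat.decreasingInduction with
  | self => simp [decompProd]
  | of_succ m hm ih =>
    have hmem : m ∉ Finset.Ico (m + 1) b := by simp
    rw [← Finset.insert_Ico_add_one_left_eq_Ico hm, Finset.sum_powerset_insert hmem,
      Finset.sum_insert hmem, ih, add_assoc, add_comm (top _ _)]
    congr 2
    rw [decompSum, map_sum, LinearMap.sum_apply]
    refine Finset.sum_congr rfl fun c hc => ?_
    have hlt : ∀ x ∈ c, m < x := fun x hx =>
      (Finset.mem_Ico.mp (Finset.mem_powerset.mp hc hx)).1
    rw [Finset.sort_insert _ (fun _ hx => (hlt _ hx).le) (fun h => (hlt m h).false)]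
    rfl

/-- The decompositions of `[a, b]`, sorted by their first interval. -/
lemma decompSum_eq (top : H →ₗ[K] H →ₗ[K] H) (p : ℕ → ℕ → H) {a b : ℕ} (hab : a ≤ b) :
    decompSum top p a b =
      p a b + ∑ j ∈ Finset.Ico a b, top (decompSum top p (j + 1) b) (p a j) :=
  sum_powerset_Ico_decompProd top p a b hab

lemma counit_decompSum {top : H →ₗ[K] H →ₗ[K] H} (htop : IsNaturalGrowth top)
    {p : ℕ → ℕ → H} {a b : ℕ} (hab : a ≤ b)
    (hp : ∀ i j, a ≤ i → i ≤ j → j ≤ b → reducedComul K H (p i j) = 0) :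
    Coalgebra.counit (R := K) (decompSum top p a b) = 0 := by
  induction hk : b - a using Nat.strong_induction_on generalizing a with
  | _ k ih =>
    subst hk
    rw [decompSum_eq top p hab, map_add, map_sum,
      counit_eq_zero_of_reducedComul_eq_zero (hp a b le_rfl hab le_rfl), zero_add]
    refine Finset.sum_eq_zero fun j hj => ?_
    obtain ⟨haj, hjb⟩ := Finset.mem_Ico.mp hj
    exact htop.counit_eq_zero
      (ih (b - (j + 1)) (by omega) hjb (fun i l hi => hp i l (by omega)) rfl)
      (hp a j le_rfl haj hjb.le)

lemma reducedComul_decompSum {top : H →ₗ[K] H →ₗ[K] H} (htop : IsNaturalGrowth top)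
    {p : ℕ → ℕ → H} {a b : ℕ} (hab : a ≤ b)
    (hp : ∀ i j, a ≤ i → i ≤ j → j ≤ b → reducedComul K H (p i j) = 0) :
    reducedComul K H (decompSum top p a b) =
      ∑ c ∈ Finset.Ico a b, decompSum top p (c + 1) b ⊗ₜ[K] decompSum top p a c := by
  induction hk : b - a using Nat.strong_induction_on generalizing a with
  | _ k ih =>
    subst hk
    have hterm : ∀ j ∈ Finset.Ico a b,
        reducedComul K H (top (decompSum top p (j + 1) b) (p a j)) =
          decompSum top p (j + 1) b ⊗ₜ[K] p a j +
            ∑ c ∈ Finset.Ico (j + 1) b,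
              decompSum top p (c + 1) b ⊗ₜ[K] top (decompSum top p (j + 1) c) (p a j) := by
      intro j hj
      obtain ⟨haj, hjb⟩ := Finset.mem_Ico.mp hj
      rw [htop _ _ (hp a j le_rfl haj hjb.le),
        ih (b - (j + 1)) (by omega) hjb (fun i l hi => hp i l (by omega)) rfl, map_sum]
      rfl
    rw [decompSum_eq top p hab, map_add, hp a b le_rfl hab le_rfl, zero_add, map_sum,
      Finset.sum_congr rfl hterm, Finset.sum_add_distrib,
      Finset.sum_comm' (t' := Finset.Ico a b) (s' := fun c => Finset.Ico a c)
        (by intro x y; simp only [Finset.mem_Ico]; omega),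
      ← Finset.sum_add_distrib]
    refine Finset.sum_congr rfl fun c hc => ?_
    rw [decompSum_eq top p (Finset.mem_Ico.mp hc).1, TensorProduct.tmul_add,
      TensorProduct.tmul_sum]

lemma comoduleCoaction_single (top : H →ₗ[K] H →ₗ[K] H) (p : ℕ → ℕ → H) (n : ℕ)
    (i : Fin (n + 1)) :
    comoduleCoaction top p n (Pi.single i 1) =
      (∑ j ∈ Finset.univ.filter (fun j : Fin (n + 1) => j < i),
        decompSum top p ((j : ℕ) + 1) (i : ℕ) ⊗ₜ[K] Pi.single j (1 : K)) +
      (1 : H) ⊗ₜ[K] Pi.single i (1 : K) := by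
  rw [comoduleCoaction, ← Pi.basisFun_apply, Module.Basis.constr_basis]
  simp only [Pi.basisFun_apply]

lemma comul_decompSum {top : H →ₗ[K] H →ₗ[K] H} (htop : IsNaturalGrowth top)
    {p : ℕ → ℕ → H} {n : ℕ}
    (hp : ∀ i j : ℕ, 1 ≤ i → i ≤ j → j ≤ n → reducedComul K H (p i j) = 0)
    {i j : Fin (n + 1)} (hji : j < i) :
    Coalgebra.comul (R := K) (decompSum top p ((j : ℕ) + 1) i) =
      (∑ k ∈ Finset.univ.filter (fun k : Fin (n + 1) => j < k ∧ k < i),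
        decompSum top p ((k : ℕ) + 1) i ⊗ₜ[K] decompSum top p ((j : ℕ) + 1) k) +
      decompSum top p ((j : ℕ) + 1) i ⊗ₜ[K] 1 + 1 ⊗ₜ[K] decompSum top p ((j : ℕ) + 1) i := by
  rw [comul_eq_reducedComul_add, reducedComul_decompSum htop hji
    fun a b ha hab hb => hp a b (by omega) hab (by omega)]
  congr 2
  symm
  refine Finset.sum_bij (fun k _ => (k : ℕ)) ?_ ?_ ?_ ?_
  · intro k hk
    simp only [Finset.mem_filter, Finset.mem_univ, true_and, Fin.lt_def] at hk
    exact Finset.mem_Ico.mpr hk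
  · intro k _ l _ h
    exact Fin.ext h
  · intro c hc
    obtain ⟨h₁, h₂⟩ := Finset.mem_Ico.mp hc
    exact ⟨⟨c, by omega⟩, Finset.mem_filter.mpr ⟨Finset.mem_univ _, h₁, h₂⟩, rfl⟩
  · intro k _
    rfl

end DecompSum

theorem comoduleCoaction_is_comodule {K H : Type*} [Field K] [CharZero K]
    [Ring H] [HopfAlgebra K H]
    (G : HopfGrading (K := K) (H := H))
    (top : H →ₗ[K] H →ₗ[K] H) (htop : IsNaturalGrowth top)
    (n : ℕ) (hn : 1 ≤ n) (p : ℕ → ℕ → H)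
    (hp : ∀ i j : ℕ, 1 ≤ i → i ≤ j → j ≤ n → reducedComul K H (p i j) = 0) :
    -- counit axiom: (ε ⊗ id) ∘ Δ_C = id
    ((TensorProduct.lid K (Fin (n + 1) → K)).toLinearMap ∘ₗ
        (TensorProduct.map (Coalgebra.counit (R := K)) LinearMap.id) ∘ₗ
        comoduleCoaction top p n = LinearMap.id) ∧
    -- coassociativity: (Δ ⊗ id) ∘ Δ_C = (id ⊗ Δ_C) ∘ Δ_C
    ((TensorProduct.assoc K H H (Fin (n + 1) → K)).toLinearMap ∘ₗ
        (TensorProduct.map (Coalgebra.comul (R := K)) LinearMap.id) ∘ₗ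
        comoduleCoaction top p n =
      (TensorProduct.map LinearMap.id (comoduleCoaction top p n)) ∘ₗ
        comoduleCoaction top p n) := by
  constructor
  · refine (Pi.basisFun K (Fin (n + 1))).ext fun i => ?_
    simp only [Pi.basisFun_apply, LinearMap.comp_apply, comoduleCoaction_single, map_add, map_sum,
      TensorProduct.map_tmul, LinearMap.id_apply, LinearEquiv.coe_coe, TensorProduct.lid_tmul,
      Bialgebra.counit_one, one_smul]
    rw [Finset.sum_eq_zero, zero_add]
    intro j hj
    have hji : j < i := (Finset.mem_filter.mp hj).2
    rw [counit_decompSum htop hji fun a b ha hab hb => hp a b (by omega) hab (by omega), zero_smul]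
  · refine (Pi.basisFun K (Fin (n + 1))).ext fun i => ?_
    have hleft : ∀ j ∈ Finset.univ.filter (fun j : Fin (n + 1) => j < i),
        TensorProduct.assoc K H H (Fin (n + 1) → K)
          (Coalgebra.comul (R := K) (decompSum top p ((j : ℕ) + 1) i) ⊗ₜ[K] Pi.single j (1 : K)) =
        (∑ k ∈ Finset.univ.filter (fun k : Fin (n + 1) => j < k ∧ k < i),
          decompSum top p ((k : ℕ) + 1) i ⊗ₜ[K]
            (decompSum top p ((j : ℕ) + 1) k ⊗ₜ[K] Pi.single j (1 : K))) +
        decompSum top p ((j : ℕ) + 1) i ⊗ₜ[K] ((1 : H) ⊗ₜ[K] Pi.single j (1 : K)) +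
        (1 : H) ⊗ₜ[K] (decompSum top p ((j : ℕ) + 1) i ⊗ₜ[K] Pi.single j (1 : K)) := by
      intro j hj
      rw [comul_decompSum htop hp (Finset.mem_filter.mp hj).2]
      simp only [TensorProduct.add_tmul, TensorProduct.sum_tmul, map_add, map_sum,
        TensorProduct.assoc_tmul]
    simp only [Pi.basisFun_apply, LinearMap.comp_apply, comoduleCoaction_single, map_add, map_sum,
      TensorProduct.map_tmul, LinearMap.id_apply, LinearEquiv.coe_coe, Bialgebra.comul_one,
      Algebra.TensorProduct.one_def, TensorProduct.assoc_tmul]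
    rw [Finset.sum_congr rfl hleft]
    simp only [TensorProduct.tmul_add, TensorProduct.tmul_sum, Finset.sum_add_distrib]
    rw [Finset.sum_comm' (t' := Finset.univ.filter (fun k : Fin (n + 1) => k < i))
      (s' := fun k => Finset.univ.filter (fun j : Fin (n + 1) => j < k))]
    · abel
    · intro j k
      simp only [Finset.mem_filter, Finset.mem_univ, true_and]
      exact ⟨fun h => h.2, fun h => ⟨h.1.trans h.2, h⟩⟩
end
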